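/- Let M, N, K be positive integers and let A ∈ ℝ^{M×N}. Define g(U,Z) = (1/2)‖A − UZ‖_F² for U ∈ ℝ^{M×K}, Z ∈ ℝ^{K×N}, and define the kernel h_a(U,Z) = 3·((‖U‖_F² + ‖Z‖_F²)/2)² + ‖A‖_F·(‖U‖_F² + ‖Z‖_F²)/2. Then for every L ≥ 1 the function (U,Z) ↦ L·h_a(U,Z) − g(U,Z) is convex on ℝ^{M×K} × ℝ^{K×N}, and there exists L' ≥ 1 such that (U,Z) ↦ L'·h_a(U,Z) + g(U,Z) is convex on ℝ^{M×K} × ℝ^{K×N}. -/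

import Mathlib

/-- Frobenius inner product of real matrices. -/
noncomputable def fip {m n : ℕ} (X Y : Matrix (Fin m) (Fin n) ℝ) : ℝ :=
  ∑ i, ∑ j, X i j * Y i j

/-- Frobenius norm of a real matrix. -/
noncomputable def fnorm {m n : ℕ} (X : Matrix (Fin m) (Fin n) ℝ) : ℝ :=
  Real.sqrt (fip X X)

theorem convexOn_univ_of_quartic_on_lines {E : Type*} [AddCommGroup E] [Module ℝ E] {f : E → ℝ}
    (hf : ∀ x d : E, ∃ c₀ c₁ c₂ c₃ c₄ : ℝ,
      (∀ t : ℝ, f (x + t • d) = c₀ + c₁ * t + c₂ * t ^ 2 + c₃ * t ^ 3 + c₄ * t ^ 4) ∧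
      ∀ s : ℝ, 0 ≤ c₂ + 3 * c₃ * s + 6 * c₄ * s ^ 2) :
    ConvexOn ℝ Set.univ f := by
  refine ⟨convex_univ, fun x _ y _ a t ha ht hat => ?_⟩
  obtain ⟨c₀, c₁, c₂, c₃, c₄, hline, hpos⟩ := hf x (y - x)
  obtain rfl : a = 1 - t := by linarith
  have h0 := hline 0
  have h1 := hline 1
  have h2 := hline t
  rw [show x + (0 : ℝ) • (y - x) = x by simp] at h0
  rw [show x + (1 : ℝ) • (y - x) = y by simp] at h1
  rw [show x + t • (y - x) = (1 - t) • x + t • y by module] at h2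
  rw [h0, h1, h2, smul_eq_mul, smul_eq_mul]
  -- Two-point quadrature: the convexity defect averages the second derivative at `(1 + t) / 3 ± v`.
  set v := Real.sqrt ((1 - t + t ^ 2) / 18)
  have hvsq : v ^ 2 = (1 - t + t ^ 2) / 18 := Real.sq_sqrt (by nlinarith [sq_nonneg (t - 1)])
  have hdefect : 0 ≤ c₂ + c₃ * (1 + t) + c₄ * (1 + t + t ^ 2) := by
    linear_combination (hpos ((1 + t) / 3 + v)) / 2 + (hpos ((1 + t) / 3 - v)) / 2 +
      6 * c₄ * hvsq
  linear_combination mul_nonneg (mul_nonneg ht ha) hdefect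

section FrobeniusInner

variable {m n k : ℕ}

theorem fip_comm (X Y : Matrix (Fin m) (Fin n) ℝ) : fip X Y = fip Y X := by
  simp only [fip, mul_comm]

theorem fip_add_left (X Y W : Matrix (Fin m) (Fin n) ℝ) :
    fip (X + Y) W = fip X W + fip Y W := by
  simp only [fip, Matrix.add_apply, add_mul, Finset.sum_add_distrib]

theorem fip_smul_left (c : ℝ) (X W : Matrix (Fin m) (Fin n) ℝ) :
    fip (c • X) W = c * fip X W := by
  simp only [fip, Matrix.smul_apply, smul_eq_mul, mul_assoc, Finset.mul_sum]

theorem fip_sub_left (X Y W : Matrix (Fin m) (Fin n) ℝ) :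
    fip (X - Y) W = fip X W - fip Y W := by
  simp only [fip, Matrix.sub_apply, sub_mul, Finset.sum_sub_distrib]

theorem fip_add_right (W X Y : Matrix (Fin m) (Fin n) ℝ) :
    fip W (X + Y) = fip W X + fip W Y := by
  simp only [fip_comm W, fip_add_left]

theorem fip_smul_right (c : ℝ) (W X : Matrix (Fin m) (Fin n) ℝ) :
    fip W (c • X) = c * fip W X := by
  simp only [fip_comm W, fip_smul_left]

theorem fip_sub_right (W X Y : Matrix (Fin m) (Fin n) ℝ) :
    fip W (X - Y) = fip W X - fip W Y := by
  simp only [fip_comm W, fip_sub_left]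

theorem fip_self_nonneg (X : Matrix (Fin m) (Fin n) ℝ) : 0 ≤ fip X X :=
  Finset.sum_nonneg fun _ _ => Finset.sum_nonneg fun _ _ => mul_self_nonneg _

theorem fnorm_nonneg (X : Matrix (Fin m) (Fin n) ℝ) : 0 ≤ fnorm X :=
  Real.sqrt_nonneg _

theorem fnorm_sq (X : Matrix (Fin m) (Fin n) ℝ) : fnorm X ^ 2 = fip X X :=
  Real.sq_sqrt (fip_self_nonneg X)

theorem abs_fip_le (X Y : Matrix (Fin m) (Fin n) ℝ) : |fip X Y| ≤ fnorm X * fnorm Y := by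
  refine abs_le_of_sq_le_sq ?_ (mul_nonneg (fnorm_nonneg X) (fnorm_nonneg Y))
  rw [mul_pow, fnorm_sq, fnorm_sq]
  simp only [fip, ← Fintype.sum_prod_type', ← pow_two]
  exact Finset.sum_mul_sq_le_sq_mul_sq _ _ _

theorem fnorm_mul_le (X : Matrix (Fin m) (Fin k) ℝ) (Y : Matrix (Fin k) (Fin n) ℝ) :
    fnorm (X * Y) ≤ fnorm X * fnorm Y := by
  refine le_of_sq_le_sq ?_ (mul_nonneg (fnorm_nonneg X) (fnorm_nonneg Y))
  rw [mul_pow, fnorm_sq, fnorm_sq, fnorm_sq]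
  calc fip (X * Y) (X * Y) ≤ ∑ i, ∑ j, (∑ l, X i l ^ 2) * ∑ l, Y l j ^ 2 := by
        refine Finset.sum_le_sum fun i _ => Finset.sum_le_sum fun j _ => ?_
        rw [Matrix.mul_apply, ← pow_two]
        exact Finset.sum_mul_sq_le_sq_mul_sq _ _ _
    _ = fip X X * fip Y Y := by
        simp only [fip, ← pow_two]
        rw [Finset.sum_comm (f := fun l j => Y l j ^ 2), Finset.sum_mul_sum]

/-- The left-hand side is the second derivative of `½‖A - UZ‖²` at `(U, Z)` along `(P, Q)`. -/
theorem abs_hessian_factorization_le (A : Matrix (Fin m) (Fin n) ℝ)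
    (U P : Matrix (Fin m) (Fin k) ℝ) (Z Q : Matrix (Fin k) (Fin n) ℝ) :
    |fip (U * Q + P * Z) (U * Q + P * Z) - 2 * fip (A - U * Z) (P * Q)| ≤
      3 / 2 * (fip U U + fip Z Z) * (fip P P + fip Q Q) + fnorm A * (fip P P + fip Q Q) := by
  have hUQ := fnorm_mul_le U Q
  have hPZ := fnorm_mul_le P Z
  have hUZ := fnorm_mul_le U Z
  have hPQ := fnorm_mul_le P Q
  have hcross : |fip (U * Q) (P * Z)| ≤ (fnorm U * fnorm Q) * (fnorm P * fnorm Z) :=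
    (abs_fip_le _ _).trans (mul_le_mul hUQ hPZ (fnorm_nonneg _)
      (mul_nonneg (fnorm_nonneg _) (fnorm_nonneg _)))
  have hprod : |fip (U * Z) (P * Q)| ≤ (fnorm U * fnorm Z) * (fnorm P * fnorm Q) :=
    (abs_fip_le _ _).trans (mul_le_mul hUZ hPQ (fnorm_nonneg _)
      (mul_nonneg (fnorm_nonneg _) (fnorm_nonneg _)))
  have hA : |fip A (P * Q)| ≤ fnorm A * (fnorm P * fnorm Q) :=
    (abs_fip_le _ _).trans (mul_le_mul_of_nonneg_left hPQ (fnorm_nonneg _))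
  have hUQsq := pow_le_pow_left₀ (fnorm_nonneg _) hUQ 2
  have hPZsq := pow_le_pow_left₀ (fnorm_nonneg _) hPZ 2
  have hS : 0 ≤ fip (U * Q + P * Z) (U * Q + P * Z) := fip_self_nonneg _
  have hSexp : fip (U * Q + P * Z) (U * Q + P * Z) =
      fnorm (U * Q) ^ 2 + 2 * fip (U * Q) (P * Z) + fnorm (P * Z) ^ 2 := by
    rw [fnorm_sq, fnorm_sq, fip_add_left, fip_add_right, fip_add_right,
      fip_comm (P * Z) (U * Q)]
    ring
  rw [fip_sub_left]
  simp only [← fnorm_sq] at hS hSexp ⊢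
  set u := fnorm U
  set z := fnorm Z
  set p := fnorm P
  set q := fnorm Q
  have hu : 0 ≤ u := fnorm_nonneg U
  have hz : 0 ≤ z := fnorm_nonneg Z
  have hp : 0 ≤ p := fnorm_nonneg P
  have hq : 0 ≤ q := fnorm_nonneg Q
  have hquad : (u * z) * (p * q) ≤ (u ^ 2 + z ^ 2) * (p ^ 2 + q ^ 2) / 4 := by
    have := mul_le_mul (two_mul_le_add_sq u z) (two_mul_le_add_sq p q) (by positivity)
      (by positivity)
    linarith
  have hApq : fnorm A * (p * q) ≤ fnorm A * (p ^ 2 + q ^ 2) / 2 := by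
    have := mul_le_mul_of_nonneg_left (two_mul_le_add_sq p q) (fnorm_nonneg A)
    linarith
  have hcs : (u * q + p * z) ^ 2 ≤ (u ^ 2 + z ^ 2) * (p ^ 2 + q ^ 2) := by
    linarith [sq_nonneg (u * p - q * z)]
  rw [abs_le] at hcross hprod hA ⊢
  constructor <;> linarith [hcross.1, hcross.2, hprod.1, hprod.2, hA.1, hA.2]

theorem convexOn_kernel_add_factorization (A : Matrix (Fin m) (Fin n) ℝ) {L e : ℝ}
    (he : |e| ≤ L) :
    ConvexOn ℝ Set.univ
      (fun p : Matrix (Fin m) (Fin k) ℝ × Matrix (Fin k) (Fin n) ℝ =>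
        L * (3 * ((fnorm p.1 ^ 2 + fnorm p.2 ^ 2) / 2) ^ 2 +
            fnorm A * ((fnorm p.1 ^ 2 + fnorm p.2 ^ 2) / 2)) +
          e * ((1 / 2) * fnorm (A - p.1 * p.2) ^ 2)) := by
  refine convexOn_univ_of_quartic_on_lines ?_
  rintro ⟨U, Z⟩ ⟨P, Q⟩
  set R := A - U * Z with hR
  set S := U * Q + P * Z with hS
  set T := P * Q with hT
  set a := fnorm A
  set ν := fip U U + fip Z Z with hν
  set β := fip U P + fip Z Q with hβ
  set μ := fip P P + fip Q Q with hμ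
  have hres (t : ℝ) : A - (U + t • P) * (Z + t • Q) = R - t • S - t ^ 2 • T := by
    simp only [hR, hS, hT, Matrix.add_mul, Matrix.mul_add, Matrix.smul_mul, Matrix.mul_smul]
    module
  have hnorm (t : ℝ) : fip (U + t • P) (U + t • P) + fip (Z + t • Q) (Z + t • Q) =
      ν + 2 * t * β + t ^ 2 * μ := by
    simp only [fip_add_left, fip_add_right, fip_smul_left, fip_smul_right, fip_comm P U,
      fip_comm Q Z, hν, hβ, hμ]
    ring
  refine ⟨L * (3 / 4 * ν ^ 2 + a / 2 * ν) + e * (fip R R / 2),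
    L * (3 * ν * β + a * β) - e * fip R S,
    L * (3 * β ^ 2 + 3 / 2 * ν * μ + a / 2 * μ) + e * (fip S S / 2 - fip R T),
    L * (3 * β * μ) + e * fip S T, L * (3 / 4 * μ ^ 2) + e * (fip T T / 2), ?_, ?_⟩
  · intro t
    simp only [Prod.smul_mk, Prod.mk_add_mk, fnorm_sq, hres, hnorm]
    simp only [fip_sub_left, fip_sub_right, fip_smul_left, fip_smul_right, fip_comm S R,
      fip_comm T R, fip_comm T S]
    ring
  · intro s
    have hbound := abs_hessian_factorization_le A (U + s • P) P (Z + s • Q) Q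
    have hdir : (U + s • P) * Q + P * (Z + s • Q) = S + (2 * s) • T := by
      simp only [hS, hT, Matrix.add_mul, Matrix.mul_add, Matrix.smul_mul, Matrix.mul_smul]
      module
    rw [hdir, hres, hnorm, ← hT, ← hμ] at hbound
    simp only [fip_add_left, fip_add_right, fip_sub_left, fip_smul_left, fip_smul_right,
      fip_comm T S] at hbound
    have hL : 0 ≤ L := (abs_nonneg e).trans he
    have heG := mul_le_mul he hbound (abs_nonneg _) hL
    rw [← abs_mul] at heG
    have hν_nonneg : 0 ≤ ν + 2 * s * β + s ^ 2 * μ := by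
      rw [← hnorm]
      exact add_nonneg (fip_self_nonneg _) (fip_self_nonneg _)
    have hμ_nonneg : 0 ≤ μ := add_nonneg (fip_self_nonneg _) (fip_self_nonneg _)
    have hgap := mul_nonneg hL (mul_nonneg hν_nonneg hμ_nonneg)
    have hgrad := mul_nonneg hL (sq_nonneg (β + s * μ))
    linear_combination (neg_le_of_abs_le heG) / 2 + 3 / 4 * hgap + 3 * hgrad

end FrobeniusInner

/-- for g(U,Z) = ½‖A − UZ‖_F² and
h_a(U,Z) = 3((‖U‖²+‖Z‖²)/2)² + ‖A‖_F (‖U‖²+‖Z‖²)/2, for every L ≥ 1 the map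
L h_a − g is convex, and there is L' ≥ 1 with L' h_a + g convex. -/
theorem stmt0 (M N K : ℕ) (hM : 0 < M) (hN : 0 < N) (hK : 0 < K)
    (A : Matrix (Fin M) (Fin N) ℝ) :
    (∀ L : ℝ, 1 ≤ L →
      ConvexOn ℝ Set.univ
        (fun p : Matrix (Fin M) (Fin K) ℝ × Matrix (Fin K) (Fin N) ℝ =>
          L * (3 * ((fnorm p.1 ^ 2 + fnorm p.2 ^ 2) / 2) ^ 2 +
               fnorm A * ((fnorm p.1 ^ 2 + fnorm p.2 ^ 2) / 2)) -
          (1 / 2) * fnorm (A - p.1 * p.2) ^ 2)) ∧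
    (∃ L' : ℝ, 1 ≤ L' ∧
      ConvexOn ℝ Set.univ
        (fun p : Matrix (Fin M) (Fin K) ℝ × Matrix (Fin K) (Fin N) ℝ =>
          L' * (3 * ((fnorm p.1 ^ 2 + fnorm p.2 ^ 2) / 2) ^ 2 +
                fnorm A * ((fnorm p.1 ^ 2 + fnorm p.2 ^ 2) / 2)) +
          (1 / 2) * fnorm (A - p.1 * p.2) ^ 2)) := by
  refine ⟨fun L hL => ?_, 1, le_rfl, ?_⟩
  · simpa only [neg_one_mul, ← sub_eq_add_neg] using
      convexOn_kernel_add_factorization (k := K) A (L := L) (e := -1) (by simpa using hL)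
  · simpa only [one_mul] using
      convexOn_kernel_add_factorization (k := K) A (L := 1) (e := 1) (by simp)
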